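/- There exists a constant c > 0 such that for every positive integer N there is a sequence of complex numbers (a_n)_{n=-N}^{N}, not all zero, with ‖∑_{n=-N}^{N} a_n e(n x + n² y − n³ (y + x³)³)‖_{L⁶([-1,1]²)} ≥ c N^{1/36} (∑_{n=-N}^{N} |a_n|²)^{1/2}. -/

import Mathlib

open MeasureTheory

/-- `e z = e^{2πiz}`. -/
noncomputable def e (t : ℝ) : ℂ := Complex.exp (2 * Real.pi * Complex.I * t)

/-- The closed square `[-1,1]²`. -/
def Sq : Set (ℝ × ℝ) := Set.Icc (-1) 1 ×ˢ Set.Icc (-1) 1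

lemma e_add (s t : ℝ) : e (s + t) = e s * e t := by
  simp only [e, ← Complex.exp_add]
  push_cast
  ring_nf

lemma norm_e (t : ℝ) : ‖e t‖ = 1 := by
  rw [e, show (2 * Real.pi * Complex.I * t : ℂ) = ((2 * Real.pi * t : ℝ) : ℂ) * Complex.I by
    push_cast; ring]
  exact Complex.norm_exp_ofReal_mul_I _

lemma half_le_re_e {t : ℝ} (ht : |t| ≤ 1 / 6) : 1 / 2 ≤ (e t).re := by
  rw [e, show (2 * Real.pi * Complex.I * t : ℂ) = ((2 * Real.pi * t : ℝ) : ℂ) * Complex.I by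
    push_cast; ring, Complex.exp_ofReal_mul_I_re, ← Real.cos_abs, ← Real.cos_pi_div_three]
  have hpi := Real.pi_pos
  have habs : |2 * Real.pi * t| ≤ Real.pi / 3 := by
    rw [abs_mul, abs_of_pos (by positivity)]
    nlinarith
  exact Real.cos_le_cos_of_nonneg_of_le_pi (abs_nonneg _) (by linarith) habs

/-- Phases that agree up to `1/6` modulo a common shift produce no cancellation. -/
lemma half_card_le_norm_sum_e {ι : Type*} (S : Finset ι) (θ : ι → ℝ) (Λ : ℝ)
    (h : ∀ i ∈ S, |θ i - Λ| ≤ 1 / 6) : (S.card : ℝ) / 2 ≤ ‖∑ i ∈ S, e (θ i)‖ := by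
  have hfac : ∑ i ∈ S, e (θ i) = e Λ * ∑ i ∈ S, e (θ i - Λ) := by
    rw [Finset.mul_sum]
    refine Finset.sum_congr rfl fun i _ => ?_
    rw [← e_add, add_sub_cancel]
  rw [hfac, norm_mul, norm_e, one_mul]
  refine le_trans ?_ (Complex.re_le_norm _)
  rw [Complex.re_sum]
  calc (S.card : ℝ) / 2 = ∑ i ∈ S, (1 / 2 : ℝ) := by simp [div_eq_mul_inv]
    _ ≤ _ := Finset.sum_le_sum fun i hi => half_le_re_e (h i hi)

/-- The phase of the exponential sum. -/
def phase (n x y : ℝ) : ℝ := n * x + n ^ 2 * y - n ^ 3 * (y + x ^ 3) ^ 3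

/-- Exact expansion of the phase differences around the base point
`(s / k ^ 3, r / k ^ 3 - (s / k ^ 3) ^ 3)`, whose tangent plane osculates the moment curve
at frequency `k ^ 6`, in rescaled coordinates. -/
lemma phase_expansion {k s r α β μ G T x₀ y₀ x y : ℝ} (hk : 0 < k)
    (hs : s ^ 2 = 1 / 6) (hr : r ^ 2 = 2 / 9)
    (hG : G = α / 2 + 3 * s * α ^ 2 / k + α ^ 3 / k ^ 2) (hT : T = β - G)
    (hx₀ : x₀ = s / k ^ 3) (hy₀ : y₀ = r / k ^ 3 - x₀ ^ 3)
    (hx : x = x₀ + α / k ^ 4) (hy : y = r / k ^ 3 + x₀ ^ 3 - 2 * x ^ 3 + β / k ^ 10) :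
    (phase (k ^ 6 - k ^ 5 * μ) x y - phase (k ^ 6 - k ^ 5 * μ) x₀ y₀) -
      (phase (k ^ 6) x y - phase (k ^ 6) x₀ y₀) =
    μ * (6 * s * α ^ 2 + 2 * α ^ 3 / k + 9 * r * T ^ 2 / k ^ 6 + 3 * T ^ 3 / k ^ 13) +
      μ ^ 2 * (-β - 9 * r * T ^ 2 / k ^ 7 - 3 * T ^ 3 / k ^ 14) +
      μ ^ 3 * (2 / 3 * T / k + 3 * r * T ^ 2 / k ^ 8 + T ^ 3 / k ^ 15) := by
  have hk' : k ≠ 0 := hk.ne'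
  have hg : x ^ 3 - x₀ ^ 3 = G / k ^ 10 := by
    rw [hx, hx₀, hG]
    field_simp
    linear_combination 6 * α * k ^ 2 * hs
  have ht : y + x ^ 3 = r / k ^ 3 + T / k ^ 10 := by
    rw [hT]
    linear_combination hy - hg
  have ht₀ : y₀ + x₀ ^ 3 = r / k ^ 3 := by rw [hy₀]; ring
  have hB : y = y₀ + (T - G) / k ^ 10 := by
    linear_combination ht - ht₀ - hg
  have hGT : β = G + T := by rw [hT]; ring
  have hC : (y + x ^ 3) ^ 3 =
      (y₀ + x₀ ^ 3) ^ 3 + (2 / 3 * T / k ^ 16 + 3 * r * T ^ 2 / k ^ 23 + T ^ 3 / k ^ 30) := by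
    rw [ht, ht₀]
    field_simp
    linear_combination 9 * T * k ^ 14 * hr
  have hV : α / k ^ 4 + 2 * k ^ 6 * ((T - G) / k ^ 10) - 3 * k ^ 12 *
      (2 / 3 * T / k ^ 16 + 3 * r * T ^ 2 / k ^ 23 + T ^ 3 / k ^ 30) =
      -(6 * s * α ^ 2 + 2 * α ^ 3 / k + 9 * r * T ^ 2 / k ^ 6 + 3 * T ^ 3 / k ^ 13) / k ^ 5 := by
    rw [hG]
    field_simp
    ring
  have hW : (T - G) / k ^ 10 - 3 * k ^ 6 *
      (2 / 3 * T / k ^ 16 + 3 * r * T ^ 2 / k ^ 23 + T ^ 3 / k ^ 30) =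
      (-β - 9 * r * T ^ 2 / k ^ 7 - 3 * T ^ 3 / k ^ 14) / k ^ 10 := by
    rw [hGT]
    field_simp
    ring
  have hCk : 2 / 3 * T / k ^ 16 + 3 * r * T ^ 2 / k ^ 23 + T ^ 3 / k ^ 30 =
      (2 / 3 * T / k + 3 * r * T ^ 2 / k ^ 8 + T ^ 3 / k ^ 15) / k ^ 15 := by
    field_simp
  have h₁ : k ^ 5 * (k ^ 5)⁻¹ = 1 := mul_inv_cancel₀ (by positivity)
  have h₂ : k ^ 10 * (k ^ 10)⁻¹ = 1 := mul_inv_cancel₀ (by positivity)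
  have h₃ : k ^ 15 * (k ^ 15)⁻¹ = 1 := mul_inv_cancel₀ (by positivity)
  simp only [phase]
  rw [hC, hB, hx]
  set a := α / k ^ 4
  set b := (T - G) / k ^ 10
  set c := 2 / 3 * T / k ^ 16 + 3 * r * T ^ 2 / k ^ 23 + T ^ 3 / k ^ 30
  set v := 6 * s * α ^ 2 + 2 * α ^ 3 / k + 9 * r * T ^ 2 / k ^ 6 + 3 * T ^ 3 / k ^ 13
  set w := -β - 9 * r * T ^ 2 / k ^ 7 - 3 * T ^ 3 / k ^ 14
  set u := 2 / 3 * T / k + 3 * r * T ^ 2 / k ^ 8 + T ^ 3 / k ^ 15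
  linear_combination (-k ^ 5 * μ) * hV + (k ^ 5 * μ) ^ 2 * hW + (k ^ 5 * μ) ^ 3 * hCk +
    μ * v * h₁ + μ ^ 2 * w * h₂ + μ ^ 3 * u * h₃

lemma abs_div_le_of_one_le {x d c : ℝ} (hd : 1 ≤ d) (hx : |x| ≤ c) : |x / d| ≤ c := by
  rw [abs_div, abs_of_pos (by linarith : 0 < d)]
  exact (div_le_self (abs_nonneg _) hd).trans hx

lemma abs_mul_le_mul {x y c d : ℝ} (hx : |x| ≤ c) (hy : |y| ≤ d) : |x * y| ≤ c * d := by
  rw [abs_mul]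
  exact mul_le_mul hx hy (abs_nonneg _) ((abs_nonneg _).trans hx)

lemma abs_pow_le_pow {x c : ℝ} (hx : |x| ≤ c) (n : ℕ) : |x ^ n| ≤ c ^ n := by
  rw [abs_pow]
  exact pow_le_pow_left₀ (abs_nonneg _) hx n

lemma abs_phase_expansion_le {k s r α β μ G T : ℝ} (hk : 1 ≤ k)
    (hs : |s| ≤ 1 / 2) (hr : |r| ≤ 1 / 2) (hα : |α| ≤ 1 / 100) (hβ : |β| ≤ 1 / 100)
    (hμ : |μ| ≤ 1)
    (hG : G = α / 2 + 3 * s * α ^ 2 / k + α ^ 3 / k ^ 2) (hT : T = β - G) :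
    |μ * (6 * s * α ^ 2 + 2 * α ^ 3 / k + 9 * r * T ^ 2 / k ^ 6 + 3 * T ^ 3 / k ^ 13) +
      μ ^ 2 * (-β - 9 * r * T ^ 2 / k ^ 7 - 3 * T ^ 3 / k ^ 14) +
      μ ^ 3 * (2 / 3 * T / k + 3 * r * T ^ 2 / k ^ 8 + T ^ 3 / k ^ 15)| ≤ 1 / 6 := by
  have hkn (n : ℕ) : 1 ≤ k ^ n := one_le_pow₀ hk
  have hα₂ := abs_pow_le_pow hα 2
  have hα₃ := abs_pow_le_pow hα 3
  have hsα := abs_mul_le_mul hs hα₂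
  have hT' : |T| ≤ 1 / 50 := by
    have h₁ := abs_div_le_of_one_le hk hsα
    have h₂ := abs_div_le_of_one_le (hkn 2) hα₃
    have hG' : G = α / 2 + 3 * (s * α ^ 2 / k) + α ^ 3 / k ^ 2 := by rw [hG]; ring
    rw [abs_le] at *
    constructor <;> linarith
  have hT₂ := abs_pow_le_pow hT' 2
  have hT₃ := abs_pow_le_pow hT' 3
  have hrT := abs_mul_le_mul hr hT₂
  have hv : |6 * s * α ^ 2 + 2 * α ^ 3 / k + 9 * r * T ^ 2 / k ^ 6 + 3 * T ^ 3 / k ^ 13| ≤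
      1 / 20 := by
    have h₁ := abs_div_le_of_one_le hk hα₃
    have h₂ := abs_div_le_of_one_le (hkn 6) hrT
    have h₃ := abs_div_le_of_one_le (hkn 13) hT₃
    rw [show 6 * s * α ^ 2 + 2 * α ^ 3 / k + 9 * r * T ^ 2 / k ^ 6 + 3 * T ^ 3 / k ^ 13 =
      6 * (s * α ^ 2) + 2 * (α ^ 3 / k) + 9 * (r * T ^ 2 / k ^ 6) + 3 * (T ^ 3 / k ^ 13) by ring]
    rw [abs_le] at *
    constructor <;> linarith
  have hw : |-β - 9 * r * T ^ 2 / k ^ 7 - 3 * T ^ 3 / k ^ 14| ≤ 1 / 20 := by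
    have h₂ := abs_div_le_of_one_le (hkn 7) hrT
    have h₃ := abs_div_le_of_one_le (hkn 14) hT₃
    rw [show -β - 9 * r * T ^ 2 / k ^ 7 - 3 * T ^ 3 / k ^ 14 =
      -β - 9 * (r * T ^ 2 / k ^ 7) - 3 * (T ^ 3 / k ^ 14) by ring]
    rw [abs_le] at *
    constructor <;> linarith
  have hu : |2 / 3 * T / k + 3 * r * T ^ 2 / k ^ 8 + T ^ 3 / k ^ 15| ≤ 1 / 20 := by
    have h₁ := abs_div_le_of_one_le hk hT'
    have h₂ := abs_div_le_of_one_le (hkn 8) hrT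
    have h₃ := abs_div_le_of_one_le (hkn 15) hT₃
    rw [show 2 / 3 * T / k + 3 * r * T ^ 2 / k ^ 8 + T ^ 3 / k ^ 15 =
      2 / 3 * (T / k) + 3 * (r * T ^ 2 / k ^ 8) + T ^ 3 / k ^ 15 by ring]
    rw [abs_le] at *
    constructor <;> linarith
  have h₁ := abs_mul_le_mul hμ hv
  have h₂ := abs_mul_le_mul (abs_pow_le_pow hμ 2) hw
  have h₃ := abs_mul_le_mul (abs_pow_le_pow hμ 3) hu
  refine (abs_add_three _ _ _).trans ?_
  linarith

/-- The curved strip on which the phases are aligned. -/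
def strip (k s r : ℝ) : Set (ℝ × ℝ) :=
  regionBetween (fun x => r / k ^ 3 + (s / k ^ 3) ^ 3 - 2 * x ^ 3 - 1 / 100 / k ^ 10)
    (fun x => r / k ^ 3 + (s / k ^ 3) ^ 3 - 2 * x ^ 3 + 1 / 100 / k ^ 10)
    (Set.Icc (s / k ^ 3 - 1 / 100 / k ^ 4) (s / k ^ 3 + 1 / 100 / k ^ 4))

lemma measurableSet_strip (k s r : ℝ) : MeasurableSet (strip k s r) :=
  measurableSet_regionBetween (by fun_prop) (by fun_prop) measurableSet_Icc

lemma volume_strip {k : ℝ} (hk : 0 < k) (s r : ℝ) :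
    volume (strip k s r) = ENNReal.ofReal (1 / 2500 / k ^ 14) := by
  rw [strip, Measure.volume_eq_prod,
    volume_regionBetween_eq_lintegral (by fun_prop) (by fun_prop) measurableSet_Icc]
  have h (c d x : ℝ) : (c - 2 * x ^ 3 + d) - (c - 2 * x ^ 3 - d) = 2 * d := by ring
  simp only [Pi.sub_apply, h]
  rw [setLIntegral_const, Real.volume_Icc, ← ENNReal.ofReal_mul (by positivity)]
  congr 1
  field_simp
  norm_num

/-- Rescaled coordinates of a point of the strip. -/
lemma exists_coords_of_mem_strip {k s r : ℝ} (hk : 0 < k) {p : ℝ × ℝ} (hp : p ∈ strip k s r) :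
    ∃ α β : ℝ, |α| ≤ 1 / 100 ∧ |β| ≤ 1 / 100 ∧ p.1 = s / k ^ 3 + α / k ^ 4 ∧
      p.2 = r / k ^ 3 + (s / k ^ 3) ^ 3 - 2 * p.1 ^ 3 + β / k ^ 10 := by
  obtain ⟨⟨h₁, h₂⟩, h₃, h₄⟩ := hp
  have h4 : 0 < k ^ 4 := by positivity
  have h10 : 0 < k ^ 10 := by positivity
  refine ⟨(p.1 - s / k ^ 3) * k ^ 4,
    (p.2 - (r / k ^ 3 + (s / k ^ 3) ^ 3 - 2 * p.1 ^ 3)) * k ^ 10, ?_, ?_, ?_, ?_⟩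
  · rw [abs_mul, abs_of_pos h4, ← le_div_iff₀ h4, abs_le]
    constructor <;> linarith
  · rw [abs_mul, abs_of_pos h10, ← le_div_iff₀ h10, abs_le]
    simp only at h₃ h₄
    constructor <;> linarith
  · rw [mul_div_cancel_right₀ _ h4.ne']; ring
  · rw [mul_div_cancel_right₀ _ h10.ne']; ring

lemma strip_subset_Sq {k s r : ℝ} (hk : 1 ≤ k) (hs : |s| ≤ 1 / 2) (hr : |r| ≤ 1 / 2) :
    strip k s r ⊆ Sq := by
  intro p hp
  obtain ⟨α, β, hα, hβ, hx, hy⟩ := exists_coords_of_mem_strip (by linarith) hp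
  have hkn (n : ℕ) : 1 ≤ k ^ n := one_le_pow₀ hk
  have hs' := abs_div_le_of_one_le (hkn 3) hs
  have hr' := abs_div_le_of_one_le (hkn 3) hr
  have hα' := abs_div_le_of_one_le (hkn 4) hα
  have hβ' := abs_div_le_of_one_le (hkn 10) hβ
  have hs₃ := abs_pow_le_pow hs' 3
  have hx' : |p.1| ≤ 51 / 100 := by
    rw [hx]
    exact (abs_add_le _ _).trans (by linarith)
  have hx₃ := abs_pow_le_pow hx' 3
  rw [abs_le] at *
  refine ⟨⟨?_, ?_⟩, ?_, ?_⟩ <;> linarith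

/-- A pointwise lower bound on a measurable subset gives a lower bound for the `L⁶` norm. -/
lemma ofReal_mul_le_eLpNorm_six {X : Type*} [MeasurableSpace X] {μ : Measure X} {f : X → ℂ}
    {Ω A : Set X} (hΩ : MeasurableSet Ω) (hΩA : Ω ⊆ A) {C v : ℝ} (hC : 0 ≤ C)
    (hv : 0 ≤ v) (hvol : μ Ω = ENNReal.ofReal v) (hf : ∀ p ∈ Ω, C ≤ ‖f p‖) :
    ENNReal.ofReal (C * v ^ ((1 : ℝ) / 6)) ≤ eLpNorm f 6 (μ.restrict A) := by
  have hind : eLpNorm (Ω.indicator fun _ => C) 6 (μ.restrict A) =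
      ENNReal.ofReal (C * v ^ ((1 : ℝ) / 6)) := by
    rw [eLpNorm_indicator_const hΩ (by norm_num) (by norm_num),
      Measure.restrict_eq_self μ hΩA, hvol, ENNReal.ofReal_mul hC,
      Real.enorm_eq_ofReal hC, ENNReal.ofReal_rpow_of_nonneg hv (by norm_num)]
    simp
  rw [← hind]
  refine eLpNorm_mono fun p => ?_
  by_cases hp : p ∈ Ω
  · simpa [hp, abs_of_nonneg hC] using hf p hp
  · simp [hp]

lemma scaling_inequality {k P : ℝ} (hk : 1 ≤ k) (hP : k ^ 5 ≤ P) :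
    1 / 10 * (k ^ 6) ^ ((1 : ℝ) / 36) * Real.sqrt P ≤
      P / 2 * (1 / 2500 / k ^ 14) ^ ((1 : ℝ) / 6) := by
  have hk0 : 0 < k := by linarith
  have hP0 : 0 < P := lt_of_lt_of_le (by positivity) hP
  refine le_of_pow_le_pow_left₀ (n := 6) (by norm_num) (by positivity) ?_
  have h₁ : ((k ^ 6) ^ ((1 : ℝ) / 36)) ^ 6 = k := by
    rw [← Real.rpow_natCast, ← Real.rpow_mul (by positivity), ← Real.rpow_natCast k,
      ← Real.rpow_mul hk0.le]
    norm_num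
  have h₂ : ((1 / 2500 / k ^ 14) ^ ((1 : ℝ) / 6)) ^ 6 = 1 / 2500 / k ^ 14 := by
    rw [← Real.rpow_natCast, ← Real.rpow_mul (by positivity)]
    norm_num
  have h₃ : Real.sqrt P ^ 6 = P ^ 3 := by
    rw [show 6 = 2 * 3 from rfl, pow_mul, Real.sq_sqrt hP0.le]
  have h₄ : k ^ 15 ≤ P ^ 3 := by
    calc k ^ 15 = (k ^ 5) ^ 3 := by ring
      _ ≤ P ^ 3 := by gcongr
  rw [mul_pow, mul_pow, mul_pow, h₁, h₂, h₃, ← mul_div_assoc, le_div_iff₀ (by positivity)]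
  have h₅ := mul_le_mul_of_nonneg_left h₄ (pow_pos hP0 3).le
  have h₆ : 0 ≤ P ^ 3 * P ^ 3 := by positivity
  nlinarith

/-- **Theorem 9 (curvature is necessary for the moment curve estimate).** There is `c > 0`
such that for every `N ≥ 1` there are coefficients `(a_n)_{n=-N}^N`, not all zero, with
`‖∑ a_n e(nx + n²y − n³(y+x³)³)‖_{L⁶([-1,1]²)} ≥ c N^{1/36} (∑ |a_n|²)^{1/2}`. -/
theorem stmt14 :
    ∃ c > (0:ℝ), ∀ N : ℕ, 0 < N → ∃ a : ℤ → ℂ,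
      (∃ n ∈ Finset.Icc (-(N:ℤ)) (N:ℤ), a n ≠ 0) ∧
      ENNReal.ofReal
          (c * (N:ℝ) ^ ((1:ℝ)/36) *
            Real.sqrt (∑ n ∈ Finset.Icc (-(N:ℤ)) (N:ℤ), ‖a n‖^2))
        ≤ eLpNorm (fun p : ℝ × ℝ =>
            ∑ n ∈ Finset.Icc (-(N:ℤ)) (N:ℤ),
              a n * e ((n:ℝ) * p.1 + (n:ℝ)^2 * p.2 - (n:ℝ)^3 * (p.2 + p.1^3)^3)) 6
          (volume.restrict Sq) := by
  refine ⟨1 / 10, by norm_num, fun N hN => ?_⟩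
  obtain ⟨k, hk, hkN⟩ : ∃ k : ℝ, 1 ≤ k ∧ k ^ 6 = N := by
    have hN1 : (1 : ℝ) ≤ N := by exact_mod_cast hN
    refine ⟨(N : ℝ) ^ ((1 : ℝ) / 6), Real.one_le_rpow hN1 (by norm_num), ?_⟩
    rw [← Real.rpow_natCast, ← Real.rpow_mul (by positivity)]
    norm_num
  have hk0 : 0 < k := by linarith
  obtain ⟨s, hs, hs'⟩ : ∃ s : ℝ, s ^ 2 = 1 / 6 ∧ |s| ≤ 1 / 2 :=
    ⟨√(1 / 6), Real.sq_sqrt (by norm_num), abs_le_of_sq_le_sq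
      (by rw [Real.sq_sqrt (by norm_num)]; norm_num) (by norm_num)⟩
  obtain ⟨r, hr, hr'⟩ : ∃ r : ℝ, r ^ 2 = 2 / 9 ∧ |r| ≤ 1 / 2 :=
    ⟨√(2 / 9), Real.sq_sqrt (by norm_num), abs_le_of_sq_le_sq
      (by rw [Real.sq_sqrt (by norm_num)]; norm_num) (by norm_num)⟩
  set x₀ : ℝ := s / k ^ 3 with hx₀
  set y₀ : ℝ := r / k ^ 3 - x₀ ^ 3 with hy₀
  set M : ℕ := ⌊k ^ 5⌋₊
  have hMk : (M : ℝ) ≤ k ^ 5 := Nat.floor_le (by positivity)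
  have hMN : M ≤ N := by
    have : (M : ℝ) ≤ N := hMk.trans (hkN ▸ pow_le_pow_right₀ hk (by norm_num))
    exact_mod_cast this
  set S : Finset ℤ := Finset.Icc ((N : ℤ) - M) N with hS
  have hScard : (S.card : ℝ) = M + 1 := by
    have : S.card = M + 1 := by
      rw [hS, Int.card_Icc]
      omega
    rw [this]
    push_cast
    rfl
  have hSsub : S ⊆ Finset.Icc (-(N : ℤ)) N := Finset.Icc_subset_Icc (by omega) le_rfl
  have hinter : Finset.Icc (-(N : ℤ)) N ∩ S = S := Finset.inter_eq_right.mpr hSsub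
  refine ⟨fun n => if n ∈ S then e (-phase n x₀ y₀) else 0,
    ⟨N, by simp, ?_⟩, ?_⟩
  · have hmem : (N : ℤ) ∈ S := by simp [hS]
    beta_reduce
    rw [if_pos hmem, ← norm_ne_zero_iff, norm_e]
    exact one_ne_zero
  have hcoeff : ∑ n ∈ Finset.Icc (-(N : ℤ)) N,
      ‖if n ∈ S then e (-phase n x₀ y₀) else 0‖ ^ 2 = (S.card : ℝ) := by
    simp [apply_ite, ite_pow, norm_e, Finset.sum_ite_mem, hinter]
  have hfun (p : ℝ × ℝ) : ∑ n ∈ Finset.Icc (-(N : ℤ)) N,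
      (if n ∈ S then e (-phase n x₀ y₀) else 0) *
        e ((n : ℝ) * p.1 + (n : ℝ) ^ 2 * p.2 - (n : ℝ) ^ 3 * (p.2 + p.1 ^ 3) ^ 3) =
      ∑ n ∈ S, e (phase n p.1 p.2 - phase n x₀ y₀) := by
    simp only [ite_mul, zero_mul, Finset.sum_ite_mem, hinter]
    refine Finset.sum_congr rfl fun n _ => ?_
    rw [← e_add, neg_add_eq_sub, ← phase]
  simp only [hcoeff, hfun]
  refine le_trans (ENNReal.ofReal_le_ofReal ?_)
    (ofReal_mul_le_eLpNorm_six (C := S.card / 2) (measurableSet_strip k s r)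
      (strip_subset_Sq hk hs' hr') (by positivity) (by positivity) (volume_strip hk0 s r) ?_)
  · rw [← hkN]
    refine scaling_inequality hk ?_
    rw [hScard]
    exact (Nat.lt_floor_add_one _).le
  intro p hp
  obtain ⟨α, β, hα, hβ, hx, hy⟩ := exists_coords_of_mem_strip hk0 hp
  refine half_card_le_norm_sum_e S _ (phase (k ^ 6) p.1 p.2 - phase (k ^ 6) x₀ y₀) fun n hn => ?_
  obtain ⟨hn₁, hn₂⟩ := Finset.mem_Icc.mp hn
  have hn₁' : (N : ℝ) - M ≤ n := by exact_mod_cast hn₁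
  have hn₂' : (n : ℝ) ≤ N := by exact_mod_cast hn₂
  have hk5 : 0 < k ^ 5 := by positivity
  obtain ⟨μ, hμ, hnμ⟩ : ∃ μ : ℝ, |μ| ≤ 1 ∧ (n : ℝ) = k ^ 6 - k ^ 5 * μ := by
    refine ⟨(N - n) / k ^ 5, ?_, ?_⟩
    · rw [abs_of_nonneg (div_nonneg (by linarith) hk5.le), div_le_one hk5]
      linarith
    · rw [mul_div_cancel₀ _ hk5.ne', hkN]
      ring
  rw [hnμ, phase_expansion hk0 hs hr rfl rfl hx₀ hy₀ hx hy]
  exact abs_phase_expansion_le hk hs' hr' hα hβ hμ rfl rfl
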